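/- Let B be a Bratteli diagram with incidence matrices (F_n), and let B̄ be the vertex subdiagram of B determined by nonempty subsets W_n ⊆ V_n; write W'_n = V_n \ W_n. Let μ̄ be a probability measure on X_B̄ invariant with respect to the tail equivalence relation of B̄, with cylinder values p̄_v^{(n)} (v ∈ W_n), and let μ̂ be its extension to the saturation X̂_B̄ ⊆ X_B. Then the following are equivalent: (1) μ̂(X̂_B̄) < ∞; (2) Σ_{n=1}^∞ Σ_{v ∈ W_{n+1}} Σ_{w ∈ W'_n} f^{(n)}_{v,w} h_w^{(n)} p̄_v^{(n+1)} < ∞; (3) Σ_{i=1}^∞ ( Σ_{w ∈ W_{i+1}} h_w^{(i+1)} p̄_w^{(i+1)} − Σ_{w ∈ W_i} h_w^{(i)} p̄_w^{(i)} ) < ∞. -/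

import Mathlib

open MeasureTheory

/-- A Bratteli diagram. -/
structure BratteliDiagram where
  V : ℕ → Type
  E : ℕ → Type
  fintypeV : ∀ n, Fintype (V n)
  fintypeE : ∀ n, Fintype (E n)
  nonemptyV : ∀ n, Nonempty (V n)
  nonemptyE : ∀ n, Nonempty (E n)
  root_subsingleton : ∀ v w : V 0, v = w
  src : ∀ n, E n → V n
  rng : ∀ n, E n → V (n + 1)
  src_surj : ∀ n, Function.Surjective (src n)
  rng_surj : ∀ n, Function.Surjective (rng n)

attribute [instance] BratteliDiagram.fintypeV BratteliDiagram.fintypeE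
  BratteliDiagram.nonemptyV BratteliDiagram.nonemptyE

namespace BratteliDiagram

variable (B : BratteliDiagram)

instance (n : ℕ) : TopologicalSpace (B.E n) := ⊥

/-- The path space `X_B` of a Bratteli diagram. -/
def PathSpace : Type :=
  { x : ∀ n, B.E n // ∀ n, B.rng n (x n) = B.src (n + 1) (x (n + 1)) }

instance : TopologicalSpace B.PathSpace := by unfold PathSpace; infer_instance

noncomputable instance : MeasurableSpace B.PathSpace := borel _

/-- The vertex at level `n` through which a path passes. -/
def endVtx (n : ℕ) (x : B.PathSpace) : B.V n := B.src n (x.1 n)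

/-- The cylinder set of paths agreeing with `x` on the first `n` edges. -/
def cyl (n : ℕ) (x : B.PathSpace) : Set B.PathSpace := { y | ∀ i < n, y.1 i = x.1 i }

/-- Tail equivalence of paths. -/
def tailEq (x y : B.PathSpace) : Prop := ∃ N, ∀ n, N ≤ n → x.1 n = y.1 n

/-- The tail equivalence relation is aperiodic: all classes are infinite. -/
def TailAperiodic : Prop := ∀ x : B.PathSpace, { y | B.tailEq x y }.Infinite

/-- A measure is invariant for the tail equivalence relation if any two
cylinder sets ending at the same vertex have equal measure. -/
def TailInvariant (μ : Measure B.PathSpace) : Prop :=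
  ∀ (n : ℕ) (x y : B.PathSpace), B.endVtx n x = B.endVtx n y →
    μ (B.cyl n x) = μ (B.cyl n y)

/-- Ergodicity with respect to the tail equivalence relation. -/
def TailErgodic (μ : Measure B.PathSpace) : Prop :=
  ∀ S : Set B.PathSpace, MeasurableSet S →
    (∀ x y, B.tailEq x y → (x ∈ S ↔ y ∈ S)) → μ S = 0 ∨ μ Sᶜ = 0

/-- The type of finite paths from the root vertex to `v`. -/
def FinPathTo : ∀ n, B.V n → Type
  | 0, _ => PUnit
  | n + 1, v => Σ e : { e : B.E n // B.rng n e = v }, FinPathTo n (B.src n e.1)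

/-- The height `h_v^{(n)}`: the number of finite paths from the root to `v`. -/
noncomputable def height (n : ℕ) (v : B.V n) : ℕ := Nat.card (B.FinPathTo n v)

/-- The number of edges from `w ∈ V_n` to `v ∈ V_{n+1}`; the entry `f^{(n)}_{v,w}`
of the incidence matrix `F_n`. -/
noncomputable def edgeCount (n : ℕ) (v : B.V (n + 1)) (w : B.V n) : ℕ :=
  Nat.card { e : B.E n // B.rng n e = v ∧ B.src n e = w }

/-- The incidence matrix `F_n`, as a real matrix. -/
noncomputable def incMat (n : ℕ) : Matrix (B.V (n + 1)) (B.V n) ℝ :=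
  fun v w => (B.edgeCount n v w : ℝ)

end BratteliDiagram

namespace BratteliDiagram

variable (B : BratteliDiagram)

/-- The path space of the vertex subdiagram determined by the vertex sets `W` :
infinite paths of `B` passing through `W_n` at every level `n ≥ 1`. -/
def vertexSubPaths (W : ∀ n, Finset (B.V n)) : Set B.PathSpace :=
  { x | ∀ n : ℕ, B.endVtx (n + 1) x ∈ W (n + 1) }

/-- The saturation of a set of paths with respect to the tail equivalence relation. -/
def saturation (S : Set B.PathSpace) : Set B.PathSpace := { x | ∃ y ∈ S, B.tailEq x y }

/-- The image of `A ⊆ X_B` under the prefix exchange replacing the first `n` edges by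
those of `y`. -/
def swapped (n : ℕ) (y : B.PathSpace) (A : Set B.PathSpace) : Set B.PathSpace :=
  { w | (∀ i < n, w.1 i = y.1 i) ∧ ∃ z ∈ A, ∀ i : ℕ, n ≤ i → w.1 i = z.1 i }

/-- Invariance with respect to the tail equivalence relation, in the strong sense: every
prefix exchange between two cylinders with the same end vertex is measure preserving. -/
def StrongTailInvariant (μ : Measure B.PathSpace) : Prop :=
  ∀ (n : ℕ) (x y : B.PathSpace), B.endVtx n x = B.endVtx n y →
    ∀ A : Set B.PathSpace, A ⊆ B.cyl n x → MeasurableSet A →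
      μ (B.swapped n y A) = μ A

/-- Invariance of a measure supported on `S` with respect to the tail equivalence
relation of the subdiagram with path space `S`: relative cylinder sets with the same
end vertex have equal measure. -/
def TailInvariantOn (S : Set B.PathSpace) (μ : Measure B.PathSpace) : Prop :=
  ∀ (n : ℕ) (x y : B.PathSpace), x ∈ S → y ∈ S → B.endVtx n x = B.endVtx n y →
    μ (B.cyl n x ∩ S) = μ (B.cyl n y ∩ S)

end BratteliDiagram

namespace BratteliDiagram

section Paths

variable {B : BratteliDiagram}

lemma endVtx_eq_of_agree {n : ℕ} {x y : B.PathSpace} (h : ∀ i < n, x.1 i = y.1 i) :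
    B.endVtx n x = B.endVtx n y := by
  cases n with
  | zero => exact B.root_subsingleton _ _
  | succ n => simp only [endVtx, ← x.2 n, ← y.2 n, h n (Nat.lt_succ_self n)]

/-- The path following `x` for the first `n` edges and `y` afterwards. -/
def splice (n : ℕ) (x y : B.PathSpace) (h : B.endVtx n x = B.endVtx n y) : B.PathSpace :=
  ⟨fun i => if i < n then x.1 i else y.1 i, fun i => by
    rcases lt_trichotomy (i + 1) n with hi | rfl | hi
    · simpa [hi, (Nat.lt_succ_self i).trans hi] using x.2 i
    · simpa [endVtx] using (x.2 i).trans h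
    · simpa [show ¬ i < n by omega, show ¬ i + 1 < n by omega] using y.2 i⟩

lemma splice_of_lt {n : ℕ} {x y : B.PathSpace} (h : B.endVtx n x = B.endVtx n y) {i : ℕ}
    (hi : i < n) : (splice n x y h).1 i = x.1 i := if_pos hi

lemma splice_of_le {n : ℕ} {x y : B.PathSpace} (h : B.endVtx n x = B.endVtx n y) {i : ℕ}
    (hi : n ≤ i) : (splice n x y h).1 i = y.1 i := if_neg (by omega)

/-- The vertices of the path obtained by following the selection `g` of outgoing edges. -/
noncomputable def selVtx (g : ∀ n, B.V n → B.E n) : ∀ n, B.V n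
  | 0 => Classical.arbitrary _
  | n + 1 => B.rng n (g n (selVtx g n))

lemma selVtx_congr {g g' : ∀ n, B.V n → B.E n} {n : ℕ} (h : ∀ i < n, g i = g' i) :
    selVtx g n = selVtx g' n := by
  induction n with
  | zero => rfl
  | succ n ih =>
    simp only [selVtx, h n (Nat.lt_succ_self n), ih fun i hi => h i (hi.trans n.lt_succ_self)]

open Classical in
lemma exists_selection_through {W : ∀ n, Set (B.V n)}
    (hWin : ∀ n, ∀ v ∈ W (n + 1), ∃ e : B.E n, B.rng n e = v ∧ B.src n e ∈ W n)
    (hWout : ∀ n, ∀ w ∈ W n, ∃ e : B.E n, B.src n e = w ∧ B.rng n e ∈ W (n + 1))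
    (n : ℕ) (e : B.E n) (he : B.src n e ∈ W n) (he' : B.rng n e ∈ W (n + 1)) :
    ∃ g : ∀ n, B.V n → B.E n, (∀ i v, B.src i (g i v) = v) ∧
      (∀ i, ∀ v ∈ W i, B.rng i (g i v) ∈ W (i + 1)) ∧ g n (selVtx g n) = e := by
  have redirect : ∀ g : ∀ n, B.V n → B.E n, (∀ i v, B.src i (g i v) = v) →
      (∀ i, ∀ v ∈ W i, B.rng i (g i v) ∈ W (i + 1)) →
      ∀ n (e : B.E n), B.rng n e ∈ W (n + 1) → selVtx g n = B.src n e →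
      ∃ g : ∀ n, B.V n → B.E n, (∀ i v, B.src i (g i v) = v) ∧
        (∀ i, ∀ v ∈ W i, B.rng i (g i v) ∈ W (i + 1)) ∧ g n (selVtx g n) = e := by
    intro g hg hgW n e he' hn
    refine ⟨Function.update g n (Function.update (g n) (B.src n e) e), ?_, ?_, ?_⟩
    · intro i v
      by_cases hi : i = n
      · subst hi
        by_cases hv : v = B.src i e
        · subst hv; simp
        · simp [hv, hg]
      · simp [hi, hg]
    · intro i v hvW
      by_cases hi : i = n
      · subst hi
        by_cases hv : v = B.src i e
        · subst hv; simpa using he'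
        · simpa [hv] using hgW i v hvW
      · simpa [hi] using hgW i v hvW
    · have : selVtx (Function.update g n (Function.update (g n) (B.src n e) e)) n
          = B.src n e := by
        rw [← hn]
        exact selVtx_congr fun i hi => Function.update_of_ne hi.ne _ _
      rw [this]
      simp
  induction n with
  | zero =>
    have : ∀ i (v : B.V i), ∃ e : B.E i, B.src i e = v ∧ (v ∈ W i → B.rng i e ∈ W (i + 1)) := by
      intro i v
      by_cases hv : v ∈ W i
      · obtain ⟨e, h, h'⟩ := hWout i v hv
        exact ⟨e, h, fun _ => h'⟩
      · obtain ⟨e, h⟩ := B.src_surj i v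
        exact ⟨e, h, fun h => absurd h hv⟩
    choose g hg hgW using this
    exact redirect g hg hgW 0 e he' (B.root_subsingleton _ _)
  | succ n ih =>
    obtain ⟨d, hd, hdW⟩ := hWin n _ he
    obtain ⟨g, hg, hgW, hgn⟩ := ih d hdW (hd ▸ he)
    refine redirect g hg hgW (n + 1) e he' ?_
    rw [selVtx, hgn, hd]

lemma exists_path_through {W : ∀ n, Set (B.V n)} (hW0 : W 0 = Set.univ)
    (hWin : ∀ n, ∀ v ∈ W (n + 1), ∃ e : B.E n, B.rng n e = v ∧ B.src n e ∈ W n)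
    (hWout : ∀ n, ∀ w ∈ W n, ∃ e : B.E n, B.src n e = w ∧ B.rng n e ∈ W (n + 1))
    (n : ℕ) (e : B.E n) (he : B.src n e ∈ W n) (he' : B.rng n e ∈ W (n + 1)) :
    ∃ x : B.PathSpace, x.1 n = e ∧ ∀ m, B.endVtx m x ∈ W m := by
  obtain ⟨g, hg, hgW, hgn⟩ := exists_selection_through hWin hWout n e he he'
  refine ⟨⟨fun i => g i (selVtx g i), fun i => by rw [hg]; rfl⟩, hgn, fun m => ?_⟩
  simp only [endVtx, hg]
  induction m with
  | zero => simp [hW0]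
  | succ m ih => exact hgW m _ ih

lemma exists_path_through_edge (n : ℕ) (e : B.E n) : ∃ x : B.PathSpace, x.1 n = e := by
  obtain ⟨x, hx, -⟩ := exists_path_through (W := fun _ => Set.univ) rfl
    (fun n v _ => by simpa using B.rng_surj n v) (fun n v _ => by simpa using B.src_surj n v)
    n e trivial trivial
  exact ⟨x, hx⟩

lemma exists_path_in_subdiagram {W : ∀ n, Finset (B.V n)} (hW0 : W 0 = Finset.univ)
    (hWin : ∀ n, ∀ v ∈ W (n + 1), ∃ e : B.E n, B.rng n e = v ∧ B.src n e ∈ W n)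
    (hWout : ∀ n, ∀ w ∈ W n, ∃ e : B.E n, B.src n e = w ∧ B.rng n e ∈ W (n + 1))
    (n : ℕ) (v : B.V n) (hv : v ∈ W n) :
    ∃ x ∈ B.vertexSubPaths W, B.endVtx n x = v := by
  obtain ⟨e, he, he'⟩ := hWout n v hv
  obtain ⟨x, hx, hxW⟩ := exists_path_through (W := fun n => (W n : Set (B.V n)))
    (by simp [hW0]) hWin hWout n e (by simpa [he] using hv) he'
  exact ⟨x, fun m => hxW (m + 1), by rw [endVtx, hx, he]⟩

end Paths

section Heights

variable (B : BratteliDiagram)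

instance finite_finPathTo : ∀ n (v : B.V n), Finite (B.FinPathTo n v)
  | 0, _ => inferInstanceAs (Finite PUnit)
  | n + 1, v =>
    have := finite_finPathTo n
    inferInstanceAs (Finite (Σ e : { e : B.E n // B.rng n e = v }, B.FinPathTo n (B.src n e.1)))

lemma height_zero (v : B.V 0) : B.height 0 v = 1 :=
  Nat.card_unique (α := PUnit)

open Classical in
lemma height_succ (n : ℕ) (v : B.V (n + 1)) :
    B.height (n + 1) v = ∑ e : B.E n, if B.rng n e = v then B.height n (B.src n e) else 0 := by
  change Nat.card (Σ e : { e : B.E n // B.rng n e = v }, B.FinPathTo n (B.src n e.1)) = _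
  rw [Nat.card_sigma, ← Finset.sum_filter]
  exact (Finset.sum_subtype (Finset.univ.filter fun e => B.rng n e = v) (by simp)
    fun e => B.height n (B.src n e)).symm

open Classical in
lemma edgeCount_eq_card (n : ℕ) (v : B.V (n + 1)) (w : B.V n) :
    B.edgeCount n v w = (Finset.univ.filter fun e => B.rng n e = v ∧ B.src n e = w).card := by
  rw [edgeCount, Nat.card_eq_fintype_card, Fintype.card_subtype]

open Classical in
/-- Summing over edges by grouping them according to their range and source. -/
lemma sum_edgeCount_mul (n : ℕ) (φ : B.V (n + 1) → B.V n → ℝ) :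
    ∑ v, ∑ w, (B.edgeCount n v w : ℝ) * φ v w = ∑ e, φ (B.rng n e) (B.src n e) := by
  rw [← Fintype.sum_prod_type', ← Finset.sum_fiberwise Finset.univ
    (fun e => (B.rng n e, B.src n e))]
  refine Finset.sum_congr rfl fun vw _ => ?_
  rw [edgeCount_eq_card, ← nsmul_eq_mul, ← Finset.sum_const]
  refine Finset.sum_congr (by ext e; simp [Prod.ext_iff]) fun e he => ?_
  simp only [Finset.mem_filter, Finset.mem_univ, true_and] at he
  simp [← he]

end Heights

section Measures

variable {B : BratteliDiagram}

instance : BorelSpace B.PathSpace := ⟨rfl⟩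

lemma measurableSet_edge (n : ℕ) (p : B.E n → Prop) :
    MeasurableSet { x : B.PathSpace | p (x.1 n) } := by
  have hc : Continuous fun x : B.PathSpace => x.1 n :=
    (continuous_apply n).comp continuous_subtype_val
  have : DiscreteTopology (B.E n) := ⟨rfl⟩
  exact ((isOpen_discrete { e | p e }).preimage hc).measurableSet

lemma measurableSet_cyl (n : ℕ) (x : B.PathSpace) : MeasurableSet (B.cyl n x) := by
  have : B.cyl n x = ⋂ i, ⋂ _ : i < n, { y : B.PathSpace | y.1 i = x.1 i } := by
    ext y; simp [cyl]
  rw [this]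
  exact MeasurableSet.iInter fun i => MeasurableSet.iInter fun _ =>
    measurableSet_edge i (· = x.1 i)

/-- A set of paths is `n`-saturated if membership depends only on the edges from level `n` on. -/
def TailSaturated (n : ℕ) (A : Set B.PathSpace) : Prop :=
  ∀ x ∈ A, ∀ y : B.PathSpace, (∀ i, n ≤ i → y.1 i = x.1 i) → y ∈ A

lemma TailSaturated.inter_edge {n : ℕ} {A : Set B.PathSpace} (hA : TailSaturated (n + 1) A)
    (e : B.E n) : TailSaturated n (A ∩ { x | x.1 n = e }) := fun x hx y hy =>
  ⟨hA x hx.1 y fun i hi => hy i (by omega), (hy n le_rfl).trans hx.2⟩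

lemma StrongTailInvariant.measure_inter_cyl_eq {μ : Measure B.PathSpace}
    (hμ : B.StrongTailInvariant μ) {n : ℕ} {A : Set B.PathSpace} (hA : TailSaturated n A)
    (hAm : MeasurableSet A) {x y : B.PathSpace} (hxy : B.endVtx n x = B.endVtx n y) :
    μ (A ∩ B.cyl n y) = μ (A ∩ B.cyl n x) := by
  rw [← hμ n x y hxy (A ∩ B.cyl n x) Set.inter_subset_right
    (hAm.inter (measurableSet_cyl n x))]
  congr 1
  ext w
  constructor
  · rintro ⟨hwA, hwy⟩
    have h : B.endVtx n x = B.endVtx n w := hxy.trans (endVtx_eq_of_agree hwy).symm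
    exact ⟨hwy, splice n x w h,
      ⟨hA w hwA _ fun i hi => splice_of_le h hi, fun i hi => splice_of_lt h hi⟩,
      fun i hi => (splice_of_le h hi).symm⟩
  · rintro ⟨hwy, z, ⟨hzA, -⟩, hwz⟩
    exact ⟨hA z hzA w hwz, hwy⟩

lemma measure_eq_sum_fiber {α ι : Type*} [MeasurableSpace α] [Fintype ι] (μ : Measure α)
    (f : α → ι) (hf : ∀ i, MeasurableSet { x | f x = i }) (T : Set α) :
    μ T = ∑ i, μ (T ∩ { x | f x = i }) := by
  have h := sum_measure_preimage_singleton (μ := μ.restrict T) Finset.univ (f := f)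
    fun i _ => hf i
  rw [Finset.coe_univ, Set.preimage_univ, Measure.restrict_apply_univ] at h
  rw [← h]
  refine Finset.sum_congr rfl fun i _ => ?_
  rw [Set.inter_comm, ← Measure.restrict_apply (hf i)]
  rfl

/-- In an `n+1`-saturated set, each of the `h_w` ways to reach an edge `e` out of `w` carries
the same mass. -/
lemma StrongTailInvariant.measure_inter_edge {μ : Measure B.PathSpace}
    (hμ : B.StrongTailInvariant μ) {n : ℕ} {A : Set B.PathSpace} (hA : TailSaturated (n + 1) A)
    (hAm : MeasurableSet A) {y : B.PathSpace} {e : B.E n} (he : B.rng n e = B.endVtx (n + 1) y) :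
    μ (A ∩ { x | x.1 n = e }) = B.height n (B.src n e) * μ (A ∩ B.cyl (n + 1) y) := by
  induction n generalizing A y with
  | zero =>
    obtain ⟨z, hz⟩ := exists_path_through_edge 0 e
    have hzy : B.endVtx 1 z = B.endVtx 1 y := by
      rw [← he, ← hz]; exact (z.2 0).symm
    have hcyl : B.cyl 1 z = { x | x.1 0 = e } := by
      ext x; simp [cyl, ← hz]
    rw [hμ.measure_inter_cyl_eq hA hAm hzy, zero_add, hcyl, height_zero, Nat.cast_one, one_mul]
  | succ n ih =>
    classical
    obtain ⟨z, hz⟩ := exists_path_through_edge (n + 1) e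
    have hzy : B.endVtx (n + 2) z = B.endVtx (n + 2) y := by
      rw [← he, ← hz]; exact (z.2 (n + 1)).symm
    have hsrc : B.endVtx (n + 1) z = B.src (n + 1) e := by rw [endVtx, hz]
    have hcyl : A ∩ B.cyl (n + 2) z = A ∩ { x | x.1 (n + 1) = e } ∩ B.cyl (n + 1) z := by
      ext x
      simp only [Set.mem_inter_iff, Set.mem_ofPred_eq, cyl, and_assoc, and_congr_right_iff]
      intro _
      rw [Nat.forall_lt_succ_right, hz, and_comm]
    rw [measure_eq_sum_fiber μ (fun x => x.1 n) (fun d => measurableSet_edge n (· = d)),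
      height_succ, Nat.cast_sum, Finset.sum_mul]
    refine Finset.sum_congr rfl fun d _ => ?_
    split_ifs with hd
    · rw [hμ.measure_inter_cyl_eq hA hAm hzy, hcyl]
      exact ih (hA.inter_edge e) (hAm.inter (measurableSet_edge (n + 1) (· = e)))
        (hd.trans hsrc.symm)
    · rw [Nat.cast_zero, zero_mul]
      refine (congrArg μ (Set.eq_empty_of_forall_notMem fun x hx => hd ?_)).trans measure_empty
      rw [← show x.1 n = d from hx.2, ← show x.1 (n + 1) = e from hx.1.2]
      exact x.2 n

/-- The paths that run through the vertices of `W` from level `N` on. -/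
def pathsIn (W : ∀ n, Finset (B.V n)) (N : ℕ) : Set B.PathSpace :=
  { x | ∀ n, N ≤ n → B.endVtx n x ∈ W n }

variable {W : ∀ n, Finset (B.V n)}

lemma measurableSet_pathsIn (N : ℕ) : MeasurableSet (pathsIn W N) := by
  have : pathsIn W N = ⋂ n, ⋂ _ : N ≤ n, { x : B.PathSpace | B.src n (x.1 n) ∈ W n } := by
    ext y; simp [pathsIn, endVtx]
  rw [this]
  exact MeasurableSet.iInter fun n => MeasurableSet.iInter fun _ =>
    measurableSet_edge n (fun e => B.src n e ∈ W n)

lemma tailSaturated_pathsIn (N : ℕ) : TailSaturated N (pathsIn W N) := fun x hx y hy n hn => by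
  rw [endVtx, hy n hn]; exact hx n hn

lemma pathsIn_mono : Monotone (pathsIn W) := fun _ _ h _ hx n hn => hx n (h.trans hn)

lemma mem_pathsIn_iff_succ {N : ℕ} {x : B.PathSpace} :
    x ∈ pathsIn W N ↔ x ∈ pathsIn W (N + 1) ∧ B.endVtx N x ∈ W N := by
  refine ⟨fun h => ⟨pathsIn_mono N.le_succ h, h N le_rfl⟩, fun h n hn => ?_⟩
  rcases hn.eq_or_lt with rfl | hn
  · exact h.2
  · exact h.1 n hn

lemma vertexSubPaths_eq (hW0 : W 0 = Finset.univ) : B.vertexSubPaths W = pathsIn W 0 := by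
  ext x
  refine ⟨fun h n _ => ?_, fun h n => h (n + 1) (Nat.zero_le _)⟩
  cases n with
  | zero => simp [hW0]
  | succ n => exact h n

lemma pathsIn_inter_cyl {n : ℕ} {y : B.PathSpace} (hy : y ∈ pathsIn W 0) :
    pathsIn W n ∩ B.cyl n y = B.cyl n y ∩ pathsIn W 0 := by
  ext x
  refine ⟨fun h => ⟨h.2, fun i _ => ?_⟩, fun h => ⟨pathsIn_mono (Nat.zero_le n) h.2, h.1⟩⟩
  rcases lt_or_ge i n with hi | hi
  · rw [endVtx, h.2 i hi]
    exact hy i (Nat.zero_le i)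
  · exact h.1 i hi

lemma saturation_eq_iUnion (hW0 : W 0 = Finset.univ)
    (hWin : ∀ n, ∀ v ∈ W (n + 1), ∃ e : B.E n, B.rng n e = v ∧ B.src n e ∈ W n)
    (hWout : ∀ n, ∀ w ∈ W n, ∃ e : B.E n, B.src n e = w ∧ B.rng n e ∈ W (n + 1)) :
    B.saturation (B.vertexSubPaths W) = ⋃ n, pathsIn W (n + 1) := by
  rw [vertexSubPaths_eq hW0]
  ext x
  rw [Set.mem_iUnion]
  constructor
  · rintro ⟨y, hy, N, hN⟩
    exact ⟨N, fun n hn => by rw [endVtx, hN n (by omega)]; exact hy n (Nat.zero_le n)⟩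
  · rintro ⟨N, hx⟩
    obtain ⟨y, hy, hyx⟩ := exists_path_in_subdiagram hW0 hWin hWout (N + 1) _ (hx _ le_rfl)
    rw [vertexSubPaths_eq hW0] at hy
    refine ⟨splice (N + 1) y x hyx, fun n _ => ?_, N + 1, fun n hn => (splice_of_le hyx hn).symm⟩
    rcases lt_or_ge n (N + 1) with hn | hn
    · rw [endVtx, splice_of_lt hyx hn]; exact hy n (Nat.zero_le n)
    · rw [endVtx, splice_of_le hyx hn]; exact hx n hn

open Classical in
/-- The mass of the paths in `W` from level `n+1` on whose `n`-th edge satisfies `P`. -/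
lemma StrongTailInvariant.measure_pathsIn_inter {μ : Measure B.PathSpace}
    (hμ : B.StrongTailInvariant μ) {n : ℕ} {q : B.V (n + 1) → ℝ}
    (hq0 : ∀ v ∈ W (n + 1), 0 ≤ q v)
    (hq : ∀ v ∈ W (n + 1), ∃ y : B.PathSpace, B.endVtx (n + 1) y = v ∧
      μ (pathsIn W (n + 1) ∩ B.cyl (n + 1) y) = ENNReal.ofReal (q v))
    (P : B.E n → Prop) :
    μ (pathsIn W (n + 1) ∩ { x | P (x.1 n) }) = ENNReal.ofReal
      (∑ e, if B.rng n e ∈ W (n + 1) ∧ P e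
        then (B.height n (B.src n e) : ℝ) * q (B.rng n e) else 0) := by
  rw [measure_eq_sum_fiber μ (fun x => x.1 n) (fun d => measurableSet_edge n (· = d)),
    ENNReal.ofReal_sum_of_nonneg fun e _ => by
      split_ifs with h
      · exact mul_nonneg (Nat.cast_nonneg _) (hq0 _ h.1)
      · exact le_rfl]
  refine Finset.sum_congr rfl fun e _ => ?_
  split_ifs with h
  · obtain ⟨y, hy, hyq⟩ := hq _ h.1
    rw [ENNReal.ofReal_mul (Nat.cast_nonneg _), ENNReal.ofReal_natCast, ← hyq,
      ← hμ.measure_inter_edge (tailSaturated_pathsIn _) (measurableSet_pathsIn _) hy.symm]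
    congr 1
    ext x
    simp only [Set.mem_inter_iff, Set.mem_ofPred_eq]
    exact ⟨fun hx => ⟨hx.1.1, hx.2⟩, fun hx => ⟨⟨hx.1, hx.2 ▸ h.2⟩, hx.2⟩⟩
  · rw [ENNReal.ofReal_zero]
    refine (congrArg μ (Set.eq_empty_of_forall_notMem fun x hx => h ?_)).trans measure_empty
    obtain ⟨⟨hxW, hxP⟩, rfl⟩ := hx
    refine ⟨?_, hxP⟩
    rw [x.2 n]
    exact hxW (n + 1) le_rfl

lemma measure_iUnion_lt_top_iff_summable {α : Type*} [MeasurableSpace α] {μ : Measure α}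
    {A : ℕ → Set α} (hA : Monotone A) {a : ℕ → ℝ} (ha0 : ∀ n, 0 ≤ a n)
    (ha : ∀ n, μ (A n) = ENNReal.ofReal (a n)) :
    μ (⋃ n, A n) < ⊤ ↔ Summable fun n => a (n + 1) - a n := by
  have hmono : Monotone a := fun m n h =>
    (ENNReal.ofReal_le_ofReal_iff (ha0 n)).1 (by rw [← ha, ← ha]; exact measure_mono (hA h))
  have hnn : ∀ n, 0 ≤ a (n + 1) - a n := fun n => sub_nonneg.2 (hmono n.le_succ)
  constructor
  · intro h
    refine summable_of_sum_range_le (c := (μ (⋃ n, A n)).toReal) hnn fun n => ?_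
    rw [Finset.sum_range_sub]
    have : a n ≤ (μ (⋃ n, A n)).toReal :=
      (ENNReal.ofReal_le_iff_le_toReal h.ne).1 (ha n ▸ measure_mono (Set.subset_iUnion A n))
    linarith [ha0 0]
  · intro h
    rw [hA.measure_iUnion]
    refine (iSup_le fun n => ?_).trans_lt
      (ENNReal.ofReal_lt_top (r := (∑' n, (a (n + 1) - a n)) + a 0))
    rw [ha]
    refine ENNReal.ofReal_le_ofReal ?_
    have := h.sum_le_tsum (Finset.range n) fun i _ => hnn i
    rw [Finset.sum_range_sub] at this
    linarith

end Measures

end BratteliDiagram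

open BratteliDiagram

open Classical in
/-- **Bezuglyi–Kwiatkowski–Karpel.** Criteria for finiteness of the tail-invariant
extension `μ̂` (to the saturation `X̂_B̄`) of a tail-invariant probability measure `μ̄` on
the path space of a vertex subdiagram `B̄ ⊆ B`: `μ̂(X̂_B̄) < ∞` iff
`Σ_n Σ_{v ∈ W_{n+1}} Σ_{w ∈ W'_n} f^{(n)}_{v,w} h^{(n)}_w p̄^{(n+1)}_v < ∞` iff
`Σ_i (Σ_{w ∈ W_{i+1}} h^{(i+1)}_w p̄^{(i+1)}_w − Σ_{w ∈ W_i} h^{(i)}_w p̄^{(i)}_w) < ∞`. -/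
theorem vertex_subdiagram_finite_extension_criteria
    (B : BratteliDiagram)
    (hCantor : ∀ x : B.PathSpace, ¬IsOpen ({x} : Set B.PathSpace))
    (W : ∀ n : ℕ, Finset (B.V n)) (hW0 : W 0 = Finset.univ)
    (hWne : ∀ n, (W n).Nonempty)
    (hWin : ∀ (n : ℕ), ∀ v ∈ W (n + 1), ∃ e : B.E n, B.rng n e = v ∧ B.src n e ∈ W n)
    (hWout : ∀ (n : ℕ), ∀ w ∈ W n, ∃ e : B.E n, B.src n e = w ∧ B.rng n e ∈ W (n + 1))
    (μbar : Measure B.PathSpace) (hprob : IsProbabilityMeasure μbar)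
    (hsupp : μbar (B.vertexSubPaths W)ᶜ = 0)
    (hinvbar : B.TailInvariantOn (B.vertexSubPaths W) μbar)
    (p : (n : ℕ) → B.V n → ℝ)
    (hp : ∀ (n : ℕ) (x : B.PathSpace), x ∈ B.vertexSubPaths W →
      p n (B.endVtx n x) = (μbar (B.cyl n x ∩ B.vertexSubPaths W)).toReal)
    (μhat : Measure B.PathSpace)
    (hinvhat : B.StrongTailInvariant μhat)
    (hsat : μhat (B.saturation (B.vertexSubPaths W))ᶜ = 0)
    (hres : μhat.restrict (B.vertexSubPaths W) = μbar) :
    (μhat (B.saturation (B.vertexSubPaths W)) < ⊤ ↔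
      Summable fun n : ℕ =>
        ∑ v : B.V (n + 2), ∑ w : B.V (n + 1),
          if v ∈ W (n + 2) ∧ w ∉ W (n + 1) then
            (B.edgeCount (n + 1) v w : ℝ) * (B.height (n + 1) w : ℝ) * p (n + 2) v
          else 0) ∧
    (μhat (B.saturation (B.vertexSubPaths W)) < ⊤ ↔
      Summable fun i : ℕ =>
        (∑ w : B.V (i + 2), if w ∈ W (i + 2) then (B.height (i + 2) w : ℝ) * p (i + 2) w
          else 0) -
        (∑ w : B.V (i + 1), if w ∈ W (i + 1) then (B.height (i + 1) w : ℝ) * p (i + 1) w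
          else 0)) := by
  have hY := vertexSubPaths_eq hW0
  rw [hY] at hp
  have hcyl : ∀ n, ∀ v ∈ W n, ∃ y : B.PathSpace, B.endVtx n y = v ∧ 0 ≤ p n v ∧
      μhat (pathsIn W n ∩ B.cyl n y) = ENNReal.ofReal (p n v) := by
    intro n v hv
    obtain ⟨y, hy, rfl⟩ := exists_path_in_subdiagram hW0 hWin hWout n v hv
    rw [hY] at hy
    have hpy := hp n y hy
    refine ⟨y, rfl, hpy ▸ ENNReal.toReal_nonneg, ?_⟩
    rw [hpy, ENNReal.ofReal_toReal (measure_ne_top _ _), pathsIn_inter_cyl hy, ← hres, hY,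
      Measure.restrict_apply ((measurableSet_cyl n y).inter (measurableSet_pathsIn 0)),
      Set.inter_assoc, Set.inter_self]
  have hmeas := fun n => hinvhat.measure_pathsIn_inter (W := W) (n := n) (q := p (n + 1))
    (fun v hv => (hcyl _ v hv).choose_spec.2.1)
    (fun v hv => (hcyl _ v hv).imp fun y hy => ⟨hy.1, hy.2.2⟩)
  set a : ℕ → ℝ := fun i =>
    ∑ w : B.V (i + 1), if w ∈ W (i + 1) then (B.height (i + 1) w : ℝ) * p (i + 1) w else 0
    with ha_def
  have ha0 : ∀ n, 0 ≤ a n := fun n => Finset.sum_nonneg fun w _ => by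
    split_ifs with hw
    · exact mul_nonneg (Nat.cast_nonneg _) (hcyl _ w hw).choose_spec.2.1
    · exact le_rfl
  have ha : ∀ n, μhat (pathsIn W (n + 1)) = ENNReal.ofReal (a n) := by
    intro n
    have h := hmeas n fun _ => True
    simp only [and_true, Set.ofPred_true, Set.inter_univ] at h
    rw [h]
    congr 1
    have hw : ∀ w : B.V (n + 1),
        (if w ∈ W (n + 1) then (B.height (n + 1) w : ℝ) * p (n + 1) w else 0) =
        ∑ e : B.E n, if B.rng n e = w then (if B.rng n e ∈ W (n + 1)
          then (B.height n (B.src n e) : ℝ) * p (n + 1) (B.rng n e) else 0) else 0 := by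
      intro w
      split_ifs with hw
      · rw [height_succ, Nat.cast_sum, Finset.sum_mul]
        refine Finset.sum_congr rfl fun e _ => ?_
        by_cases he : B.rng n e = w
        · subst he; simp [hw]
        · simp [he]
      · refine (Finset.sum_eq_zero fun e _ => ?_).symm
        by_cases he : B.rng n e = w
        · subst he; simp [hw]
        · simp [he]
    simp only [ha_def, hw]
    rw [Finset.sum_comm]
    simp
  have hterm : ∀ n, (∑ v : B.V (n + 2), ∑ w : B.V (n + 1),
      if v ∈ W (n + 2) ∧ w ∉ W (n + 1) then
        (B.edgeCount (n + 1) v w : ℝ) * (B.height (n + 1) w : ℝ) * p (n + 2) v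
      else 0) = a (n + 1) - a n := by
    intro n
    have hmono : pathsIn W (n + 1) ⊆ pathsIn W (n + 2) := pathsIn_mono (Nat.le_succ _)
    have hsum := sum_edgeCount_mul B (n + 1) fun v w =>
      if v ∈ W (n + 1 + 1) ∧ w ∉ W (n + 1)
        then (B.height (n + 1) w : ℝ) * p (n + 1 + 1) v else 0
    have hdiff : pathsIn W (n + 2) ∩ { x | B.src (n + 1) (x.1 (n + 1)) ∉ W (n + 1) } =
        pathsIn W (n + 2) \ pathsIn W (n + 1) := by
      ext x
      rw [Set.mem_sdiff, mem_pathsIn_iff_succ (N := n + 1)]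
      simp only [Set.mem_inter_iff, Set.mem_ofPred_eq, endVtx]
      tauto
    have h := hmeas (n + 1) fun e => B.src (n + 1) e ∉ W (n + 1)
    rw [hdiff, measure_sdiff hmono (measurableSet_pathsIn _).nullMeasurableSet
      (by rw [ha]; exact ENNReal.ofReal_ne_top), ha, ha, ← ENNReal.ofReal_sub _ (ha0 n)] at h
    replace h := h.trans (congrArg ENNReal.ofReal (Eq.trans (by congr!) hsum.symm))
    have hle : a n ≤ a (n + 1) := (ENNReal.ofReal_le_ofReal_iff (ha0 _)).1
      (by rw [← ha, ← ha]; exact measure_mono hmono)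
    rw [ENNReal.ofReal_eq_ofReal_iff (sub_nonneg.2 hle) (Finset.sum_nonneg fun v _ =>
      Finset.sum_nonneg fun w _ => ?_)] at h
    · rw [h]
      simp only [mul_ite, mul_zero, mul_assoc]
    · refine mul_nonneg (Nat.cast_nonneg _) ?_
      split_ifs with hv
      · exact mul_nonneg (Nat.cast_nonneg _) (hcyl _ v hv.1).choose_spec.2.1
      · exact le_rfl
  have key : μhat (B.saturation (B.vertexSubPaths W)) < ⊤ ↔
      Summable fun n => a (n + 1) - a n := by
    rw [saturation_eq_iUnion hW0 hWin hWout]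
    exact measure_iUnion_lt_top_iff_summable
      (fun m n h => pathsIn_mono (Nat.succ_le_succ h)) ha0 ha
  refine ⟨?_, key⟩
  simp only [hterm]
  exact key
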